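/- arXiv:1703.02578 — 2 statements merged into one kernel-verified Lean document; each statement's English description precedes it below -/
import Mathlib

section
/- The form Q restricted to the kernel of ∂ is positive definite: for every nonzero v ∈ ℝ^K with ∂(v) = 0, one has Q(v,v) > 0. -/
open scoped Classical

/-!  The six sides of a hexagon, in cyclic order, are labelled by
`a, ā, b, b̄, c, c̄`, identified with `0, 1, 2, 3, 4, 5 : Fin 6`. -/

/-- Two sides of the hexagon are adjacent. -/
def AdjacentSide (s t : Fin 6) : Prop :=
  ((s : ℕ) + 1) % 6 = (t : ℕ) ∨ ((t : ℕ) + 1) % 6 = (s : ℕ)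

/-- A chord: an unordered pair of two non-adjacent sides of the hexagon. -/
def Chord : Type :=
  {p : Finset (Fin 6) // p.card = 2 ∧ ∀ s ∈ p, ∀ t ∈ p, s ≠ t → ¬ AdjacentSide s t}

noncomputable instance : Fintype Chord := by
  unfold Chord; infer_instance

/-- `u` lies strictly between `s` and `t` in the cyclic order (going from `s` to `t`). -/
def BtwArc (s t u : Fin 6) : Prop :=
  0 < ((u : ℕ) + 6 - (s : ℕ)) % 6 ∧ ((u : ℕ) + 6 - (s : ℕ)) % 6 < ((t : ℕ) + 6 - (s : ℕ)) % 6

/-- Two chords cross: they have no side in common, and the two sides of one lie in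
different arcs of the cyclic order determined by the two sides of the other. -/
def Crosses (k k' : Finset (Fin 6)) : Prop :=
  Disjoint k k' ∧ ∃ s t u v : Fin 6, k = {s, t} ∧ k' = {u, v} ∧ s ≠ t ∧ u ≠ v ∧
    (BtwArc s t u ↔ ¬ BtwArc s t v)

/-- The symmetric bilinear form `Q` on `ℝ^K`: `Q(k, k') = 1` if the chords `k, k'` cross
and `0` otherwise. -/
noncomputable def Qform (f g : Chord → ℝ) : ℝ :=
  ∑ k : Chord, ∑ k' : Chord, (if Crosses k.1 k'.1 then (1 : ℝ) else 0) * f k * g k'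

/-- The vector in `ℝ³` contributed by each side: `a, b, c` contribute `e₁, e₂, e₃` and
`ā, b̄, c̄` contribute `-e₁, -e₂, -e₃`. -/
def sideVec : Fin 6 → Fin 3 → ℝ :=
  ![![1, 0, 0], ![-1, 0, 0], ![0, 1, 0], ![0, -1, 0], ![0, 0, 1], ![0, 0, -1]]

/-- The boundary map `∂ : ℝ^K → ℝ³`. -/
noncomputable def bdry (f : Chord → ℝ) : Fin 3 → ℝ :=
  ∑ k : Chord, f k • (∑ s ∈ k.1, sideVec s)

/-- The length functional `λ : ℝ^K → ℝ` (the sum of the coordinates). -/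
noncomputable def lamFun (f : Chord → ℝ) : ℝ := ∑ k : Chord, f k

instance (s t : Fin 6) : Decidable (AdjacentSide s t) := by
  unfold AdjacentSide; infer_instance

instance (s t u : Fin 6) : Decidable (BtwArc s t u) := by
  unfold BtwArc; infer_instance

instance (k k' : Finset (Fin 6)) : Decidable (Crosses k k') := by
  unfold Crosses
  exact @instDecidableAnd _ _ (Finset.decidableDisjoint k k') inferInstance

/-- The nine chords, as sets of sides, in lexicographic order. -/
def chordSides : Fin 9 → Finset (Fin 6) :=
  ![{0, 2}, {0, 3}, {0, 4}, {1, 3}, {1, 4}, {1, 5}, {2, 4}, {2, 5}, {3, 5}]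

/-- The crossing matrix of the nine chords. -/
def crossingMatrix : Fin 9 → Fin 9 → ℕ :=
  ![![0, 0, 0, 1, 1, 1, 0, 0, 0],
    ![0, 0, 0, 0, 1, 1, 1, 1, 0],
    ![0, 0, 0, 0, 0, 1, 0, 1, 1],
    ![1, 0, 0, 0, 0, 0, 1, 1, 0],
    ![1, 1, 0, 0, 0, 0, 0, 1, 1],
    ![1, 1, 1, 0, 0, 0, 0, 0, 0],
    ![0, 1, 0, 1, 0, 0, 0, 0, 1],
    ![0, 1, 1, 1, 1, 0, 0, 0, 0],
    ![0, 0, 1, 0, 1, 0, 1, 0, 0]]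

theorem crosses_chordSides (i j : Fin 9) :
    Crosses (chordSides i) (chordSides j) ↔ crossingMatrix i j = 1 := by
  revert i j
  decide +kernel

theorem crossingMatrix_eq_zero_or_one (i j : Fin 9) :
    crossingMatrix i j = 0 ∨ crossingMatrix i j = 1 := by
  revert i j
  decide +kernel

theorem ite_crosses_chordSides (i j : Fin 9)
    {_ : Decidable (Crosses (chordSides i) (chordSides j))} :
    (if Crosses (chordSides i) (chordSides j) then (1 : ℝ) else 0) = crossingMatrix i j := by
  rcases crossingMatrix_eq_zero_or_one i j with h | h <;> simp [crosses_chordSides, h]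

theorem chordSides_isChord (i : Fin 9) : (chordSides i).card = 2 ∧
    ∀ s ∈ chordSides i, ∀ t ∈ chordSides i, s ≠ t → ¬ AdjacentSide s t := by
  revert i
  decide +kernel

theorem chordSides_injective : Function.Injective chordSides := by
  unfold Function.Injective
  decide +kernel

theorem exists_chordSides_eq (p : Finset (Fin 6))
    (hp : p.card = 2 ∧ ∀ s ∈ p, ∀ t ∈ p, s ≠ t → ¬ AdjacentSide s t) :
    ∃ i, chordSides i = p := by
  revert p
  decide +kernel

/-- The enumeration of the chords by `Fin 9`. -/
noncomputable def chordEquiv : Fin 9 ≃ Chord :=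
  Equiv.ofBijective (fun i => ⟨chordSides i, chordSides_isChord i⟩)
    ⟨fun _ _ h => chordSides_injective (congrArg Subtype.val h),
      fun k => (exists_chordSides_eq k.1 k.2).imp fun _ h => Subtype.ext h⟩

theorem coe_chordEquiv (i : Fin 9) : (chordEquiv i).1 = chordSides i := rfl

theorem Qform_eq (f : Chord → ℝ) :
    Qform f f = ∑ i, ∑ j, (crossingMatrix i j : ℝ) * f (chordEquiv i) * f (chordEquiv j) := by
  unfold Qform
  rw [← chordEquiv.sum_comp]
  refine Finset.sum_congr rfl fun i _ => ?_
  rw [← chordEquiv.sum_comp]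
  refine Finset.sum_congr rfl fun j _ => ?_
  exact congrArg (· * f (chordEquiv i) * f (chordEquiv j)) (ite_crosses_chordSides i j)

theorem bdry_eq (f : Chord → ℝ) :
    bdry f = ∑ i, f (chordEquiv i) • ∑ s ∈ chordSides i, sideVec s := by
  unfold bdry
  rw [← chordEquiv.sum_comp]
  simp only [coe_chordEquiv]

theorem almost_simple_geodesics_stmt13 (f : Chord → ℝ) (hf : bdry f = 0) (hne : f ≠ 0) :
    0 < Qform f f := by
  obtain ⟨x, hx⟩ : ∃ x : Fin 9 → ℝ, ∀ i, f (chordEquiv i) = x i := ⟨_, fun _ => rfl⟩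
  rw [bdry_eq] at hf
  have ha := congrFun hf 0
  have hb := congrFun hf 1
  have hc := congrFun hf 2
  simp [hx, Fin.sum_univ_succ, chordSides, sideVec] at ha hb hc
  have hp : x 0 = x 3 + x 4 - x 7 := by linarith
  have hq : x 1 = x 4 + x 6 - x 8 := by linarith
  have hr : x 2 = -x 4 + x 5 - x 6 + x 7 + x 8 := by linarith
  have hQ : Qform f f = 2 * (x 3 + x 4 + x 5 / 2 + x 6 / 2) ^ 2 + 2 * (x 4 + x 6 / 2 - x 8 / 2) ^ 2
      + 3 / 2 * (x 5 - x 6 / 3 + 2 / 3 * x 7 + 2 / 3 * x 8) ^ 2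
      + 5 / 6 * (x 6 + 2 / 5 * x 7 - x 8 / 5) ^ 2 + 6 / 5 * (x 7 + x 8 / 3) ^ 2
      + 2 / 3 * x 8 ^ 2 := by
    rw [Qform_eq]
    simp [hx, Fin.sum_univ_succ, crossingMatrix]
    rw [hp, hq, hr]
    ring
  rw [hQ]
  by_contra! hneg
  have h8 : x 8 = 0 := by
    refine pow_eq_zero_iff two_ne_zero |>.mp (le_antisymm ?_ (sq_nonneg _))
    linarith only [hneg, sq_nonneg (x 3 + x 4 + x 5 / 2 + x 6 / 2),
      sq_nonneg (x 4 + x 6 / 2 - x 8 / 2), sq_nonneg (x 5 - x 6 / 3 + 2 / 3 * x 7 + 2 / 3 * x 8),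
      sq_nonneg (x 6 + 2 / 5 * x 7 - x 8 / 5), sq_nonneg (x 7 + x 8 / 3)]
  have h7 : x 7 + x 8 / 3 = 0 := by
    refine pow_eq_zero_iff two_ne_zero |>.mp (le_antisymm ?_ (sq_nonneg _))
    linarith only [hneg, sq_nonneg (x 3 + x 4 + x 5 / 2 + x 6 / 2),
      sq_nonneg (x 4 + x 6 / 2 - x 8 / 2), sq_nonneg (x 5 - x 6 / 3 + 2 / 3 * x 7 + 2 / 3 * x 8),
      sq_nonneg (x 6 + 2 / 5 * x 7 - x 8 / 5), sq_nonneg (x 8)]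
  have h6 : x 6 + 2 / 5 * x 7 - x 8 / 5 = 0 := by
    refine pow_eq_zero_iff two_ne_zero |>.mp (le_antisymm ?_ (sq_nonneg _))
    linarith only [hneg, sq_nonneg (x 3 + x 4 + x 5 / 2 + x 6 / 2),
      sq_nonneg (x 4 + x 6 / 2 - x 8 / 2), sq_nonneg (x 5 - x 6 / 3 + 2 / 3 * x 7 + 2 / 3 * x 8),
      sq_nonneg (x 7 + x 8 / 3), sq_nonneg (x 8)]
  have h5 : x 5 - x 6 / 3 + 2 / 3 * x 7 + 2 / 3 * x 8 = 0 := by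
    refine pow_eq_zero_iff two_ne_zero |>.mp (le_antisymm ?_ (sq_nonneg _))
    linarith only [hneg, sq_nonneg (x 3 + x 4 + x 5 / 2 + x 6 / 2),
      sq_nonneg (x 4 + x 6 / 2 - x 8 / 2), sq_nonneg (x 6 + 2 / 5 * x 7 - x 8 / 5),
      sq_nonneg (x 7 + x 8 / 3), sq_nonneg (x 8)]
  have h4 : x 4 + x 6 / 2 - x 8 / 2 = 0 := by
    refine pow_eq_zero_iff two_ne_zero |>.mp (le_antisymm ?_ (sq_nonneg _))
    linarith only [hneg, sq_nonneg (x 3 + x 4 + x 5 / 2 + x 6 / 2),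
      sq_nonneg (x 5 - x 6 / 3 + 2 / 3 * x 7 + 2 / 3 * x 8),
      sq_nonneg (x 6 + 2 / 5 * x 7 - x 8 / 5), sq_nonneg (x 7 + x 8 / 3), sq_nonneg (x 8)]
  have h3 : x 3 + x 4 + x 5 / 2 + x 6 / 2 = 0 := by
    refine pow_eq_zero_iff two_ne_zero |>.mp (le_antisymm ?_ (sq_nonneg _))
    linarith only [hneg, sq_nonneg (x 4 + x 6 / 2 - x 8 / 2),
      sq_nonneg (x 5 - x 6 / 3 + 2 / 3 * x 7 + 2 / 3 * x 8),
      sq_nonneg (x 6 + 2 / 5 * x 7 - x 8 / 5), sq_nonneg (x 7 + x 8 / 3), sq_nonneg (x 8)]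
  refine hne (funext fun k => ?_)
  obtain ⟨i, rfl⟩ := chordEquiv.surjective k
  rw [hx]
  fin_cases i <;> simp <;> linarith
end

section
/- For every v ∈ ℝ^K with ∂(v) = 0, one has Q(v,v) ≥ λ(v)²/3. -/
open scoped Classical

/-- The first side of each of the nine chords. -/
def chordFst : Fin 9 → Fin 6 := ![0, 0, 0, 1, 1, 1, 2, 2, 3]

/-- The second side of each of the nine chords. -/
def chordSnd : Fin 9 → Fin 6 := ![2, 3, 4, 3, 4, 5, 4, 5, 5]

/-- The chord with a given number. -/
def chordOf (i : Fin 9) : Chord :=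
  ⟨{chordFst i, chordSnd i}, by
    unfold AdjacentSide
    revert i
    decide⟩

theorem chordOf_bijective : Function.Bijective chordOf := by
  constructor
  · intro i j h
    have h' : ({chordFst i, chordSnd i} : Finset (Fin 6)) = {chordFst j, chordSnd j} :=
      congrArg Subtype.val h
    clear h
    revert i j
    decide
  · rintro ⟨p, hp, hadj⟩
    obtain ⟨s, t, hst, rfl⟩ := Finset.card_eq_two.mp hp
    have hna : ¬ AdjacentSide s t := hadj s (by simp) t (by simp) hst
    have key : ∀ s t : Fin 6, s ≠ t →
        ¬ (((s : ℕ) + 1) % 6 = (t : ℕ) ∨ ((t : ℕ) + 1) % 6 = (s : ℕ)) →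
        ∃ i, ({chordFst i, chordSnd i} : Finset (Fin 6)) = {s, t} := by
      decide
    obtain ⟨i, hi⟩ := key s t hst hna
    exact ⟨i, Subtype.ext hi⟩

theorem sum_chord {M : Type*} [AddCommMonoid M] (g : Chord → M) :
    ∑ k, g k = ∑ i, g (chordOf i) :=
  (chordOf_bijective.sum_comp g).symm

theorem btwArc_swap : ∀ s t u : Fin 6, s ≠ t → u ≠ s → u ≠ t →
    (BtwArc t s u ↔ ¬ BtwArc s t u) := by
  decide

theorem crosses_pair_iff {s t u v : Fin 6} (hst : s ≠ t) (huv : u ≠ v) :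
    Crosses {s, t} {u, v} ↔
      (s ≠ u ∧ s ≠ v ∧ t ≠ u ∧ t ≠ v) ∧ (BtwArc s t u ↔ ¬ BtwArc s t v) := by
  have hdisj : Disjoint ({s, t} : Finset (Fin 6)) {u, v} ↔
      s ≠ u ∧ s ≠ v ∧ t ≠ u ∧ t ≠ v := by
    simp
    tauto
  unfold Crosses
  rw [hdisj]
  refine and_congr_right fun ⟨hsu, hsv, htu, htv⟩ => ⟨?_, fun h => ⟨s, t, u, v, rfl, rfl, hst, huv, h⟩⟩
  rintro ⟨s', t', u', v', hk, hk', -, -, h⟩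
  have hu := btwArc_swap s t u hst hsu.symm htu.symm
  have hv := btwArc_swap s t v hst hsv.symm htv.symm
  have hpair : ∀ {a b c d : Fin 6}, ({a, b} : Finset (Fin 6)) = {c, d} →
      (a = c ∧ b = d) ∨ (a = d ∧ b = c) := by
    intro a b c d h
    have h' : ({a, b} : Set (Fin 6)) = {c, d} := by
      simpa using congrArg (fun x : Finset (Fin 6) => (x : Set (Fin 6))) h
    exact Set.pair_eq_pair_iff.mp h'
  rcases hpair hk with ⟨rfl, rfl⟩ | ⟨rfl, rfl⟩ <;>
    rcases hpair hk' with ⟨rfl, rfl⟩ | ⟨rfl, rfl⟩ <;> tauto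

theorem chordFst_ne_chordSnd : ∀ i, chordFst i ≠ chordSnd i := by decide

/-- Crossing of the numbered chords, as a Boolean-valued function. -/
def crossNum (i j : Fin 9) : Bool :=
  decide ((chordFst i ≠ chordFst j ∧ chordFst i ≠ chordSnd j ∧
      chordSnd i ≠ chordFst j ∧ chordSnd i ≠ chordSnd j) ∧
    (BtwArc (chordFst i) (chordSnd i) (chordFst j) ↔
      ¬ BtwArc (chordFst i) (chordSnd i) (chordSnd j)))

theorem crosses_chordOf_iff (i j : Fin 9) :
    Crosses (chordOf i).1 (chordOf j).1 ↔ crossNum i j = true := by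
  rw [crossNum, decide_eq_true_iff]
  exact crosses_pair_iff (chordFst_ne_chordSnd i) (chordFst_ne_chordSnd j)

/-- For each chord, the list of the chords crossing it. -/
def crossTable : Fin 9 → Finset (Fin 9) :=
  ![{3, 4, 5}, {4, 5, 6, 7}, {5, 7, 8}, {0, 6, 7}, {0, 1, 7, 8}, {0, 1, 2}, {1, 3, 8},
    {1, 2, 3, 4}, {2, 4, 6}]

theorem crossNum_iff_mem_crossTable :
    ∀ i j, crossNum i j = true ↔ j ∈ crossTable i := by decide

theorem Qform_eq_sum_crossTable (f : Chord → ℝ) :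
    Qform f f = ∑ i, f (chordOf i) * ∑ j ∈ crossTable i, f (chordOf j) := by
  simp only [Qform, sum_chord, crosses_chordOf_iff, crossNum_iff_mem_crossTable, ite_mul,
    one_mul, zero_mul, Finset.sum_ite_mem, Finset.univ_inter, Finset.mul_sum]

theorem bdry_apply (f : Chord → ℝ) (c : Fin 3) :
    bdry f c =
      ∑ i, f (chordOf i) * (sideVec (chordFst i) c + sideVec (chordSnd i) c) := by
  have h : ∀ i, ∑ s ∈ (chordOf i).1, sideVec s c =
      sideVec (chordFst i) c + sideVec (chordSnd i) c := fun i =>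
    Finset.sum_pair (chordFst_ne_chordSnd i)
  simp only [bdry, sum_chord, h, Finset.sum_apply, Pi.smul_apply, smul_eq_mul]

theorem almost_simple_geodesics_stmt14 (f : Chord → ℝ) (hf : bdry f = 0) :
    lamFun f ^ 2 / 3 ≤ Qform f f := by
  have h0 := bdry_apply f 0
  have h1 := bdry_apply f 1
  have h2 := bdry_apply f 2
  rw [hf] at h0 h1 h2
  rw [Qform_eq_sum_crossTable, lamFun, sum_chord]
  simp [Fin.sum_univ_succ, chordFst, chordSnd, sideVec, crossTable] at h0 h1 h2 ⊢
  have e2 : f (chordOf 2) = f (chordOf 5) + f (chordOf 7) - f (chordOf 1) := by linarith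
  have e0 : f (chordOf 0) = f (chordOf 3) + f (chordOf 4) - f (chordOf 7) := by linarith
  have e8 : f (chordOf 8) = f (chordOf 4) - f (chordOf 1) + f (chordOf 6) := by linarith
  rw [e0, e2, e8]
  generalize f (chordOf 1) = x₁, f (chordOf 3) = x₃, f (chordOf 4) = x₄, f (chordOf 5) = x₅,
    f (chordOf 6) = x₆, f (chordOf 7) = x₇
  linarith [sq_nonneg (5 * x₁ + 2 * x₃ - x₅ - x₆ - 2 * x₇), sq_nonneg (2 * x₃ - x₅ - x₆ - 2 * x₇),
    sq_nonneg x₄, sq_nonneg (x₅ - x₆), sq_nonneg x₇]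
end
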